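/- Let w : ℝ × ℝ → ℝ be a smooth nowhere-zero function satisfying the KdV eigenfunction equation w_t = w_xxx − 3 w_x w_xx / w at every point. Let a, b, c, d be real numbers with ad − bc > 0, and let F : ℝ × ℝ → ℝ be a smooth function with F_x = w² and F_t = 2 w w_xx − 4 w_x² at every point, such that cF + d is nowhere zero. Then the function ŵ := √(ad − bc) · w / (cF + d) is smooth, nowhere zero, and satisfies the KdV eigenfunction equation ŵ_t = ŵ_xxx − 3 ŵ_x ŵ_xx / ŵ at every point. -/

import Mathlib

/-- Partial derivative with respect to the first (space) variable. -/
noncomputable def px (f : ℝ × ℝ → ℝ) : ℝ × ℝ → ℝ :=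
  fun p => deriv (fun x => f (x, p.2)) p.1

/-- Partial derivative with respect to the second (time) variable. -/
noncomputable def pt (f : ℝ × ℝ → ℝ) : ℝ × ℝ → ℝ :=
  fun p => deriv (fun t => f (p.1, t)) p.2

theorem hasDerivAt_px {f : ℝ × ℝ → ℝ} (hf : ContDiff ℝ (⊤ : ℕ∞) f) (p : ℝ × ℝ) :
    HasDerivAt (fun x => f (x, p.2)) (px f p) p.1 := by
  have h : ContDiff ℝ (⊤ : ℕ∞) (fun x : ℝ => f (x, p.2)) := by fun_prop
  exact (h.differentiable (by simp) p.1).hasDerivAt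

theorem hasDerivAt_pt {f : ℝ × ℝ → ℝ} (hf : ContDiff ℝ (⊤ : ℕ∞) f) (p : ℝ × ℝ) :
    HasDerivAt (fun t => f (p.1, t)) (pt f p) p.2 := by
  have h : ContDiff ℝ (⊤ : ℕ∞) (fun t : ℝ => f (p.1, t)) := by fun_prop
  exact (h.differentiable (by simp) p.2).hasDerivAt

theorem contDiff_px {f : ℝ × ℝ → ℝ} (hf : ContDiff ℝ (⊤ : ℕ∞) f) :
    ContDiff ℝ (⊤ : ℕ∞) (px f) := by
  have h : px f = fun p => fderiv ℝ f p (1, 0) := by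
    funext p
    have hline : HasDerivAt (fun x : ℝ => (x, p.2)) ((1 : ℝ), (0 : ℝ)) p.1 :=
      (hasDerivAt_id p.1).prodMk (hasDerivAt_const p.1 p.2)
    have hfd : HasFDerivAt f (fderiv ℝ f p) (p.1, p.2) :=
      (hf.differentiable (by simp) p).hasFDerivAt
    exact (hfd.comp_hasDerivAt p.1 hline).deriv
  rw [h]
  exact (hf.fderiv_right (m := (⊤ : ℕ∞)) (by simp)).clm_apply contDiff_const

/-- Invariance I of the KdV eigenfunction equation: if `w` solves it, `ad - bc > 0`,
and `F` is a potential with `F_x = w²`, `F_t = 2 w w_xx - 4 w_x²` with `cF + d` nowhere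
zero, then `ŵ := √(ad - bc) · w / (cF + d)` is smooth, nowhere zero and solves the KdV
eigenfunction equation. -/
theorem kdvEigenfunction_invariance_I
    (w : ℝ × ℝ → ℝ) (hw : ContDiff ℝ (⊤ : ℕ∞) w) (hw0 : ∀ p, w p ≠ 0)
    (heq : ∀ p, pt w p = px (px (px w)) p - 3 * px w p * px (px w) p / w p)
    (a b c d : ℝ) (habcd : a * d - b * c > 0)
    (F : ℝ × ℝ → ℝ) (hF : ContDiff ℝ (⊤ : ℕ∞) F)
    (hFx : ∀ p, px F p = (w p) ^ 2)
    (hFt : ∀ p, pt F p = 2 * w p * px (px w) p - 4 * (px w p) ^ 2)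
    (hcFd : ∀ p, c * F p + d ≠ 0) :
    ContDiff ℝ (⊤ : ℕ∞) (fun q => Real.sqrt (a * d - b * c) * w q / (c * F q + d)) ∧
    (∀ p, (fun q => Real.sqrt (a * d - b * c) * w q / (c * F q + d)) p ≠ 0) ∧
    (∀ p, pt (fun q => Real.sqrt (a * d - b * c) * w q / (c * F q + d)) p =
        px (px (px (fun q => Real.sqrt (a * d - b * c) * w q / (c * F q + d)))) p -
          3 * px (fun q => Real.sqrt (a * d - b * c) * w q / (c * F q + d)) p *
            px (px (fun q => Real.sqrt (a * d - b * c) * w q / (c * F q + d))) p /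
            (fun q => Real.sqrt (a * d - b * c) * w q / (c * F q + d)) p) := by
  set s := Real.sqrt (a * d - b * c)
  have hs0 : s ≠ 0 := (Real.sqrt_pos.mpr habcd).ne'
  have hw1 := contDiff_px hw
  have hw2 := contDiff_px hw1
  have dF (p : ℝ × ℝ) : HasDerivAt (fun x => c * F (x, p.2) + d) (c * w p ^ 2) p.1 := by
    have h := hasDerivAt_px hF p
    rw [hFx] at h
    exact (h.const_mul c).add_const d
  have e1 : px (fun q => s * w q / (c * F q + d)) =
      fun q => s * (px w q / (c * F q + d) - c * w q ^ 3 / (c * F q + d) ^ 2) := by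
    funext p
    have h0 := hcFd p
    refine ((((hasDerivAt_px hw p).const_mul s).div (dF p) h0).congr_deriv ?_).deriv
    simp only [Prod.mk.eta]
    field_simp
  have e2 : px (fun q => s * (px w q / (c * F q + d) - c * w q ^ 3 / (c * F q + d) ^ 2)) =
      fun q => s * (px (px w) q / (c * F q + d) - 4 * c * w q ^ 2 * px w q / (c * F q + d) ^ 2
        + 2 * c ^ 2 * w q ^ 5 / (c * F q + d) ^ 3) := by
    funext p
    have h0 := hcFd p
    refine (((((hasDerivAt_px hw1 p).div (dF p) h0).sub
      ((((hasDerivAt_px hw p).pow 3).const_mul c).div ((dF p).pow 2)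
        (pow_ne_zero 2 h0))).const_mul s).congr_deriv ?_).deriv
    simp only [Prod.mk.eta, Pi.pow_apply]
    field_simp
    push_cast
    ring
  have e3 : px (fun q => s * (px (px w) q / (c * F q + d)
        - 4 * c * w q ^ 2 * px w q / (c * F q + d) ^ 2
        + 2 * c ^ 2 * w q ^ 5 / (c * F q + d) ^ 3)) =
      fun q => s * (px (px (px w)) q / (c * F q + d)
        - c * (5 * w q ^ 2 * px (px w) q + 8 * w q * px w q ^ 2) / (c * F q + d) ^ 2
        + 18 * c ^ 2 * w q ^ 4 * px w q / (c * F q + d) ^ 3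
        - 6 * c ^ 3 * w q ^ 7 / (c * F q + d) ^ 4) := by
    funext p
    have h0 := hcFd p
    refine ((((((hasDerivAt_px hw2 p).div (dF p) h0).sub
      (((((hasDerivAt_px hw p).pow 2).const_mul (4 * c)).mul (hasDerivAt_px hw1 p)).div
        ((dF p).pow 2) (pow_ne_zero 2 h0))).add
      ((((hasDerivAt_px hw p).pow 5).const_mul (2 * c ^ 2)).div ((dF p).pow 3)
        (pow_ne_zero 3 h0))).const_mul s).congr_deriv ?_).deriv
    simp only [Prod.mk.eta, Pi.pow_apply, Pi.mul_apply]
    field_simp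
    push_cast
    ring
  refine ⟨(contDiff_const.mul hw).div ((contDiff_const.mul hF).add contDiff_const) hcFd,
    fun p => div_ne_zero (mul_ne_zero hs0 (hw0 p)) (hcFd p), fun p => ?_⟩
  have h0 := hcFd p
  have hwp := hw0 p
  have et : pt (fun q => s * w q / (c * F q + d)) p =
      s * (pt w p / (c * F p + d) - w p * (c * pt F p) / (c * F p + d) ^ 2) := by
    refine ((((hasDerivAt_pt hw p).const_mul s).div
      (((hasDerivAt_pt hF p).const_mul c).add_const d) h0).congr_deriv ?_).deriv
    simp only [Prod.mk.eta]
    field_simp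
  rw [e1, e2, e3, et, heq, hFt]
  field_simp
  ring
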